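/- Let T be a p × p real matrix all of whose complex eigenvalues have negative real part, let π be a row vector in ℝ^p with nonnegative entries summing to one, and set t = −T𝟙 where 𝟙 is the all-ones column vector. Let e_1, …, e_d > 0 and y ∈ ℕ₀^d, with y_• = Σ_i y_i and e_• = Σ_i e_i. Then ∫_0^∞ ∏_{i=1}^d ((θ e_i)^{y_i}/y_i!) e^{-θ e_i} · π e^{Tθ} t dθ = (∏_{i=1}^d e_i^{y_i}) · (y_•! / ∏_{i=1}^d y_i!) · π (e_• I − T)^{-(y_• + 1)} t. -/

import Mathlib

open MeasureTheory Real Set Matrix Finset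

/-- The matrix exponential `e^M = Σ_{r ≥ 0} M^r / r!`. -/
noncomputable def matExp {p : ℕ} (M : Matrix (Fin p) (Fin p) ℝ) :
    Matrix (Fin p) (Fin p) ℝ :=
  ∑' r : ℕ, ((r.factorial : ℝ)⁻¹) • M ^ r

section MatrixExponential

attribute [local instance] Matrix.linftyOpNormedRing Matrix.linftyOpNormedAlgebra

open Asymptotics Filter

theorem matExp_eq_exp {p : ℕ} (M : Matrix (Fin p) (Fin p) ℝ) :
    matExp M = NormedSpace.exp M := by
  rw [NormedSpace.exp_eq_tsum ℝ]; rfl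

theorem exp_mulVec_of_pow_mulVec_eq_zero {p k : ℕ} (N : Matrix (Fin p) (Fin p) ℂ)
    (v : Fin p → ℂ) (h : N ^ k *ᵥ v = 0) (θ : ℝ) :
    NormedSpace.exp (θ • N) *ᵥ v =
      ∑ j ∈ Finset.range k, (θ ^ j / (j.factorial : ℝ)) • (N ^ j *ᵥ v) := by
  have hs := NormedSpace.exp_series_hasSum_exp' (𝕂 := ℝ) (θ • N)
  have hs' := hs.map (Matrix.mulVec.addMonoidHomLeft v) (by
    change Continuous fun M : Matrix (Fin p) (Fin p) ℂ => M *ᵥ v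
    fun_prop)
  refine hs'.unique ?_
  have hfun : ((Matrix.mulVec.addMonoidHomLeft v) ∘
      fun n : ℕ => ((n.factorial : ℝ)⁻¹) • (θ • N) ^ n) =
      fun j => (θ ^ j / (j.factorial : ℝ)) • (N ^ j *ᵥ v) := by
    funext j
    change (((j.factorial : ℝ)⁻¹) • (θ • N) ^ j) *ᵥ v = _
    rw [smul_pow, smul_smul, Matrix.smul_mulVec]
    congr 1
    ring
  rw [hfun]
  refine hasSum_sum_of_ne_finset_zero fun j hj => ?_
  have hkj : k ≤ j := by simpa using hj
  obtain ⟨m, rfl⟩ := Nat.exists_eq_add_of_le' hkj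
  rw [pow_add N, ← Matrix.mulVec_mulVec, h, Matrix.mulVec_zero, smul_zero]

theorem exp_smul_eq_smul_exp_sub {p : ℕ} (A : Matrix (Fin p) (Fin p) ℂ) (μ : ℂ) (θ : ℝ) :
    NormedSpace.exp (θ • A) =
      Complex.exp (θ * μ) • NormedSpace.exp (θ • (A - μ • (1 : Matrix (Fin p) (Fin p) ℂ))) := by
  have h1 : θ • A = algebraMap ℂ (Matrix (Fin p) (Fin p) ℂ) (θ * μ) +
      θ • (A - μ • (1 : Matrix (Fin p) (Fin p) ℂ)) := by
    rw [Algebra.algebraMap_eq_smul_one, mul_smul, smul_sub, Complex.coe_smul]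
    abel
  have h2 : NormedSpace.exp (algebraMap ℂ (Matrix (Fin p) (Fin p) ℂ) (θ * μ)) =
      algebraMap ℂ (Matrix (Fin p) (Fin p) ℂ) (Complex.exp (θ * μ)) := by
    rw [Complex.exp_eq_exp_ℂ]
    exact (NormedSpace.algebraMap_exp_comm (θ * μ : ℂ)).symm
  rw [h1, Matrix.exp_add_of_commute _ _ (Algebra.commute_algebraMap_left _ _), h2,
    ← Algebra.smul_def]

theorem isBigO_dotProduct_exp_mulVec_of_pow_mulVec_eq_zero {p k : ℕ}
    (A : Matrix (Fin p) (Fin p) ℂ) {μ : ℂ} (hμ : μ.re ≤ 0) (w v : Fin p → ℂ)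
    (h : (A - μ • (1 : Matrix (Fin p) (Fin p) ℂ)) ^ k *ᵥ v = 0) {ε : ℝ} (hε : 0 < ε) :
    (fun θ : ℝ => w ⬝ᵥ (NormedSpace.exp (θ • A) *ᵥ v)) =O[atTop] fun θ => Real.exp (ε * θ) := by
  have hfun : (fun θ : ℝ => w ⬝ᵥ (NormedSpace.exp (θ • A) *ᵥ v)) = fun θ : ℝ =>
      Complex.exp (θ * μ) * ∑ j ∈ Finset.range k, ((θ ^ j : ℝ) : ℂ) *
        (((j.factorial : ℂ)⁻¹) * (w ⬝ᵥ ((A - μ • (1 : Matrix (Fin p) (Fin p) ℂ)) ^ j *ᵥ v))) := by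
    funext θ
    rw [exp_smul_eq_smul_exp_sub A μ, Matrix.smul_mulVec,
      exp_mulVec_of_pow_mulVec_eq_zero _ _ h, dotProduct_smul, smul_eq_mul, dotProduct_sum]
    congr 1
    refine Finset.sum_congr rfl fun j _ => ?_
    rw [dotProduct_smul, Complex.real_smul]
    push_cast
    ring
  rw [hfun]
  have hexp : (fun θ : ℝ => Complex.exp (θ * μ)) =O[atTop] fun _ : ℝ => (1 : ℝ) := by
    refine IsBigO.of_bound 1 ?_
    filter_upwards [eventually_ge_atTop 0] with θ hθ
    have : θ * μ.re ≤ 0 := mul_nonpos_of_nonneg_of_nonpos hθ hμ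
    simpa [Complex.norm_exp] using this
  refine (hexp.mul (IsBigO.fun_sum (g := fun θ : ℝ => Real.exp (ε * θ)) fun j _ => ?_)).congr_right
    fun θ => one_mul _
  have hpow : (fun θ : ℝ => ((θ ^ j : ℝ) : ℂ)) =O[atTop] fun θ => Real.exp (ε * θ) :=
    (Complex.isBigO_ofReal_left).2 (isLittleO_pow_exp_pos_mul_atTop j hε).isBigO
  exact (hpow.const_mul_left _).congr_left fun θ => mul_comm _ _

theorem isBigO_dotProduct_exp_mulVec {p : ℕ} (A : Matrix (Fin p) (Fin p) ℂ)
    (hA : ∀ z ∈ spectrum ℂ A, z.re ≤ 0) (w v : Fin p → ℂ) {ε : ℝ} (hε : 0 < ε) :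
    (fun θ : ℝ => w ⬝ᵥ (NormedSpace.exp (θ • A) *ᵥ v)) =O[atTop] fun θ => Real.exp (ε * θ) := by
  have hv : v ∈ ⨆ μ, Module.End.maxGenEigenspace (Matrix.toLinAlgEquiv' A) μ := by
    rw [Module.End.iSup_maxGenEigenspace_eq_top]; trivial
  refine Submodule.iSup_induction _ (motive := fun v : Fin p → ℂ => (fun θ : ℝ =>
    w ⬝ᵥ (NormedSpace.exp (θ • A) *ᵥ v)) =O[atTop] fun θ => Real.exp (ε * θ)) hv
    (fun μ x hx => ?_) ?_ fun x y hx hy => ?_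
  · obtain ⟨k, hk⟩ := (Module.End.mem_maxGenEigenspace _ _ _).1 hx
    replace hk : (A - μ • (1 : Matrix (Fin p) (Fin p) ℂ)) ^ k *ᵥ x = 0 := by
      rw [← Matrix.toLinAlgEquiv'_apply, map_pow, map_sub, map_smul, map_one]
      exact hk
    by_cases hμ : μ ∈ spectrum ℂ A
    · exact isBigO_dotProduct_exp_mulVec_of_pow_mulVec_eq_zero A (hA μ hμ) w x hk hε
    · have hu : IsUnit ((A - μ • (1 : Matrix (Fin p) (Fin p) ℂ)) ^ k) := by
        rw [spectrum.notMem_iff, Algebra.algebraMap_eq_smul_one, IsUnit.sub_iff] at hμ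
        exact hμ.pow k
      have hx0 : x = 0 := Matrix.mulVec_injective_of_isUnit hu (by simpa using hk)
      simp [hx0, isBigO_zero]
  · simp [isBigO_zero]
  · simpa only [Matrix.mulVec_add, dotProduct_add] using hx.add hy

theorem isBigO_dotProduct_exp_mulVec_real {p : ℕ} (T : Matrix (Fin p) (Fin p) ℝ)
    (hT : ∀ z ∈ spectrum ℂ (T.map Complex.ofReal), z.re ≤ 0) (w v : Fin p → ℝ)
    {ε : ℝ} (hε : 0 < ε) :
    (fun θ : ℝ => w ⬝ᵥ (NormedSpace.exp (θ • T) *ᵥ v)) =O[atTop] fun θ => Real.exp (ε * θ) := by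
  have h := isBigO_dotProduct_exp_mulVec _ hT (Complex.ofReal ∘ w) (Complex.ofReal ∘ v) hε
  refine Complex.isBigO_ofReal_left.1 (h.congr_left fun θ => ?_)
  have hmap : NormedSpace.exp (θ • T.map Complex.ofReal) =
      (NormedSpace.exp (θ • T)).map Complex.ofReal := by
    have hc : Continuous (Complex.ofRealHom.mapMatrix :
        Matrix (Fin p) (Fin p) ℝ →+* Matrix (Fin p) (Fin p) ℂ) :=
      continuous_id.matrix_map Complex.continuous_ofReal
    refine Eq.trans ?_ (NormedSpace.map_exp _ hc (θ • T)).symm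
    congr 1
    ext i j
    simp
  rw [hmap]
  simp [dotProduct, Matrix.mulVec]

theorem hasDerivAt_dotProduct_exp_smul_mulVec {p : ℕ} (T : Matrix (Fin p) (Fin p) ℝ)
    (w v : Fin p → ℝ) (θ : ℝ) :
    HasDerivAt (fun θ : ℝ => w ⬝ᵥ (NormedSpace.exp (θ • T) *ᵥ v))
      (w ⬝ᵥ (NormedSpace.exp (θ • T) *ᵥ (T *ᵥ v))) θ := by
  let L : Matrix (Fin p) (Fin p) ℝ →ₗ[ℝ] ℝ :=
    { toFun := fun M => w ⬝ᵥ (M *ᵥ v)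
      map_add' := fun M N => by rw [Matrix.add_mulVec, dotProduct_add]
      map_smul' := fun c M => by rw [Matrix.smul_mulVec, dotProduct_smul]; rfl }
  have h := L.toContinuousLinearMap.hasFDerivAt.comp_hasDerivAt θ
    (hasDerivAt_exp_smul_const (𝕂 := ℝ) T θ)
  rw [Matrix.mulVec_mulVec]
  exact h

theorem isBigO_pow_mul_exp_neg_mul_dotProduct_exp {p : ℕ} (T : Matrix (Fin p) (Fin p) ℝ)
    (hT : ∀ z ∈ spectrum ℂ (T.map Complex.ofReal), z.re ≤ 0) {c : ℝ} (hc : 0 < c)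
    (w v : Fin p → ℝ) (n : ℕ) :
    (fun θ : ℝ => θ ^ n * Real.exp (-(c * θ)) * (w ⬝ᵥ (NormedSpace.exp (θ • T) *ᵥ v)))
      =O[atTop] fun θ => Real.exp (-(c / 3) * θ) := by
  have h1 := (isLittleO_pow_exp_pos_mul_atTop n (b := c / 3) (by positivity)).isBigO
  have h2 := isBigO_dotProduct_exp_mulVec_real T hT w v (ε := c / 3) (by positivity)
  refine ((h1.mul (isBigO_refl (fun θ : ℝ => Real.exp (-(c * θ))) atTop)).mul h2).congr_right
    fun θ => ?_
  rw [← Real.exp_add, ← Real.exp_add]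
  congr 1
  ring

theorem integrableOn_pow_mul_exp_neg_mul_dotProduct_exp {p : ℕ} (T : Matrix (Fin p) (Fin p) ℝ)
    (hT : ∀ z ∈ spectrum ℂ (T.map Complex.ofReal), z.re ≤ 0) {c : ℝ} (hc : 0 < c)
    (w v : Fin p → ℝ) (n : ℕ) :
    IntegrableOn
      (fun θ : ℝ => θ ^ n * Real.exp (-(c * θ)) * (w ⬝ᵥ (NormedSpace.exp (θ • T) *ᵥ v)))
      (Set.Ioi 0) := by
  have hd : Continuous fun θ : ℝ => w ⬝ᵥ (NormedSpace.exp (θ • T) *ᵥ v) :=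
    continuous_iff_continuousAt.2 fun θ =>
      (hasDerivAt_dotProduct_exp_smul_mulVec T w v θ).continuousAt
  exact integrable_of_isBigO_exp_neg (b := c / 3) (by positivity)
    (by fun_prop) (isBigO_pow_mul_exp_neg_mul_dotProduct_exp T hT hc w v n)

theorem tendsto_pow_mul_exp_neg_mul_dotProduct_exp {p : ℕ} (T : Matrix (Fin p) (Fin p) ℝ)
    (hT : ∀ z ∈ spectrum ℂ (T.map Complex.ofReal), z.re ≤ 0) {c : ℝ} (hc : 0 < c)
    (w v : Fin p → ℝ) (n : ℕ) :
    Tendsto (fun θ : ℝ => θ ^ n * Real.exp (-(c * θ)) * (w ⬝ᵥ (NormedSpace.exp (θ • T) *ᵥ v)))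
      atTop (nhds 0) := by
  refine (isBigO_pow_mul_exp_neg_mul_dotProduct_exp T hT hc w v n).trans_tendsto ?_
  refine Real.tendsto_exp_atBot.comp (tendsto_id.const_mul_atTop_of_neg ?_)
  linarith

theorem isUnit_smul_one_sub {p : ℕ} (T : Matrix (Fin p) (Fin p) ℝ)
    (hT : ∀ z ∈ spectrum ℂ (T.map Complex.ofReal), z.re ≤ 0) {c : ℝ} (hc : 0 < c) :
    IsUnit (c • (1 : Matrix (Fin p) (Fin p) ℝ) - T) := by
  have h : (c : ℂ) ∉ spectrum ℂ (T.map Complex.ofReal) := fun h => by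
    have := hT _ h
    rw [Complex.ofReal_re] at this
    linarith
  have hmap : algebraMap ℂ (Matrix (Fin p) (Fin p) ℂ) c - T.map Complex.ofReal =
      Complex.ofRealHom.mapMatrix (c • (1 : Matrix (Fin p) (Fin p) ℝ) - T) := by
    ext i j
    by_cases hij : i = j <;> simp [hij, Matrix.algebraMap_matrix_apply]
  rw [spectrum.notMem_iff, hmap, Matrix.isUnit_iff_isUnit_det, ← RingHom.map_det,
    isUnit_iff_ne_zero, map_ne_zero] at h
  rwa [Matrix.isUnit_iff_isUnit_det, isUnit_iff_ne_zero]

theorem integral_pow_mul_exp_neg_mul_dotProduct_exp {p : ℕ} (T : Matrix (Fin p) (Fin p) ℝ)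
    (hT : ∀ z ∈ spectrum ℂ (T.map Complex.ofReal), z.re ≤ 0) {c : ℝ} (hc : 0 < c)
    (w u : Fin p → ℝ) (n : ℕ) :
    ∫ θ in Set.Ioi (0 : ℝ),
        θ ^ n * Real.exp (-(c * θ)) * (w ⬝ᵥ (NormedSpace.exp (θ • T) *ᵥ u)) =
      n.factorial *
        (w ⬝ᵥ ((c • (1 : Matrix (Fin p) (Fin p) ℝ) - T)⁻¹ ^ (n + 1) *ᵥ u)) := by
  set R := (c • (1 : Matrix (Fin p) (Fin p) ℝ) - T)⁻¹ with hR
  have hTR (u : Fin p → ℝ) : T *ᵥ (R *ᵥ u) = c • (R *ᵥ u) - u := by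
    have h1 := Matrix.mul_nonsing_inv _
      ((Matrix.isUnit_iff_isUnit_det _).1 (isUnit_smul_one_sub T hT hc))
    have h2 := congrArg (· *ᵥ u) h1
    simp only [← hR, ← Matrix.mulVec_mulVec, Matrix.sub_mulVec, Matrix.smul_mulVec,
      Matrix.one_mulVec] at h2
    rw [eq_sub_iff_add_eq, ← sub_eq_iff_eq_add'.1 h2]
  have hderiv (u : Fin p → ℝ) (n : ℕ) (θ : ℝ) : HasDerivAt
      (fun θ : ℝ => θ ^ n * Real.exp (-(c * θ)) * (w ⬝ᵥ (NormedSpace.exp (θ • T) *ᵥ (R *ᵥ u))))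
      (n * (θ ^ (n - 1) * Real.exp (-(c * θ)) * (w ⬝ᵥ (NormedSpace.exp (θ • T) *ᵥ (R *ᵥ u)))) -
        θ ^ n * Real.exp (-(c * θ)) * (w ⬝ᵥ (NormedSpace.exp (θ • T) *ᵥ u))) θ := by
    have h1 : HasDerivAt (fun θ : ℝ => Real.exp (-(c * θ))) (Real.exp (-(c * θ)) * -(c * 1)) θ :=
      (((hasDerivAt_id θ).const_mul c).neg).exp
    refine (((hasDerivAt_pow n θ).mul h1).mul
      (hasDerivAt_dotProduct_exp_smul_mulVec T w (R *ᵥ u) θ)).congr_deriv ?_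
    rw [hTR, Matrix.mulVec_sub, Matrix.mulVec_smul, dotProduct_sub, dotProduct_smul, smul_eq_mul]
    simp only [Pi.mul_apply]
    ring
  have hrec (u : Fin p → ℝ) (n : ℕ) := integral_Ioi_of_hasDerivAt_of_tendsto'
    (fun θ _ => hderiv u n θ)
    (((integrableOn_pow_mul_exp_neg_mul_dotProduct_exp T hT hc w (R *ᵥ u) (n - 1)).const_mul
      (n : ℝ)).sub (integrableOn_pow_mul_exp_neg_mul_dotProduct_exp T hT hc w u n))
    (tendsto_pow_mul_exp_neg_mul_dotProduct_exp T hT hc w (R *ᵥ u) n)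
  have hsplit (u : Fin p → ℝ) (n : ℕ) := integral_sub
    ((integrableOn_pow_mul_exp_neg_mul_dotProduct_exp T hT hc w (R *ᵥ u) (n - 1)).const_mul
      (n : ℝ)) (integrableOn_pow_mul_exp_neg_mul_dotProduct_exp T hT hc w u n)
  simp only [hsplit, integral_const_mul] at hrec
  induction n generalizing u with
  | zero =>
    have h := hrec u 0
    simp at h
    simpa using h
  | succ n ih =>
    have h := hrec u (n + 1)
    rw [Nat.add_sub_cancel, ih (R *ᵥ u), Matrix.mulVec_mulVec, ← pow_succ] at h
    simp only [ne_eq, Nat.add_eq_zero_iff, one_ne_zero, and_false, not_false_eq_true, zero_pow,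
      zero_mul, sub_zero] at h
    rw [Nat.factorial_succ]
    push_cast at h ⊢
    linarith

end MatrixExponential

/-- Mixed Poisson with phase-type mixing `Θ ~ PH(π, T)` (density
`π e^{Tθ} t`, `t = −T𝟙`): for exposures `e_i > 0` and counts `y ∈ ℕ₀^d`,
`∫_0^∞ ∏_i ((θe_i)^{y_i}/y_i!) e^{-θe_i} · π e^{Tθ} t dθ
  = (∏_i e_i^{y_i}) (y_•!/∏_i y_i!) π (e_• I − T)^{-(y_•+1)} t`. -/
theorem mixed_poisson_phase_type_pmf
    (p : ℕ) (T : Matrix (Fin p) (Fin p) ℝ)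
    (hT : ∀ z ∈ spectrum ℂ (T.map Complex.ofReal), z.re < 0)
    (piv : Fin p → ℝ) (hpiv0 : ∀ i, 0 ≤ piv i) (hpiv1 : ∑ i, piv i = 1)
    (tvec : Fin p → ℝ) (htvec : tvec = -(T *ᵥ (fun _ => (1 : ℝ))))
    (d : ℕ) (hd : 0 < d) (e : Fin d → ℝ) (he : ∀ i, 0 < e i) (y : Fin d → ℕ) :
    (∫ θ in Set.Ioi (0 : ℝ),
        (∏ i, (θ * e i) ^ (y i) / ((y i).factorial : ℝ) * Real.exp (-(θ * e i)))
          * (piv ⬝ᵥ (matExp (θ • T) *ᵥ tvec)))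
      = (∏ i, (e i) ^ (y i))
          * (((∑ i, y i).factorial : ℝ) / ∏ i, ((y i).factorial : ℝ))
          * (piv ⬝ᵥ
              ((((∑ i, e i) • (1 : Matrix (Fin p) (Fin p) ℝ) - T)⁻¹ ^ ((∑ i, y i) + 1))
                *ᵥ tvec)) := by
  have : Nonempty (Fin d) := ⟨⟨0, hd⟩⟩
  have hc : 0 < ∑ i, e i := Finset.sum_pos (fun i _ => he i) Finset.univ_nonempty
  have hint := integral_pow_mul_exp_neg_mul_dotProduct_exp T (fun z hz => (hT z hz).le) hc
    piv tvec (∑ i, y i)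
  rw [mul_assoc, div_mul_eq_mul_div, ← hint, div_eq_inv_mul, ← mul_assoc, ← integral_const_mul]
  congr 1
  funext θ
  have hprod : (∏ i, (θ * e i) ^ (y i) / ((y i).factorial : ℝ) * Real.exp (-(θ * e i))) =
      (∏ i, (e i) ^ (y i)) * (∏ i, ((y i).factorial : ℝ))⁻¹ *
        (θ ^ (∑ i, y i) * Real.exp (-((∑ i, e i) * θ))) := by
    rw [Finset.prod_mul_distrib, Finset.prod_div_distrib, ← Real.exp_sum,
      Finset.sum_neg_distrib, ← Finset.mul_sum, mul_comm θ (∑ i, e i)]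
    simp only [mul_pow, Finset.prod_mul_distrib, Finset.prod_pow_eq_pow_sum]
    ring
  rw [hprod, matExp_eq_exp]
  ring
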